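/- (Fermionic Fischer decomposition.) In the purely fermionic case, for every 0 ≤ k ≤ n: (i) 𝒫^f_k is the internal direct sum 𝒫^f_k = ⊕_{i=0}^{⌊k/2⌋} x`^{2i} ℋ^f_{k−2i}; (ii) multiplication by x`^{2(n−k)} is a linear isomorphism from 𝒫^f_k onto 𝒫^f_{2n−k}; (iii) 𝒫^f_{2n−k} is the internal direct sum 𝒫^f_{2n−k} = ⊕_{i=0}^{⌊k/2⌋} x`^{2(n−k+i)} ℋ^f_{k−2i}. -/

import Mathlib

set_option synthInstance.maxHeartbeats 1000000
set_option maxHeartbeats 1000000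

noncomputable section

/-- The Grassmann algebra Λ_{2n} on `2n` anticommuting generators. -/
abbrev Grass (n : ℕ) := ExteriorAlgebra ℝ (Fin (2*n) → ℝ)

/-- The fermionic generator x`_i. -/
def fgen (n : ℕ) (i : Fin (2*n)) : Grass n :=
  ExteriorAlgebra.ι ℝ (Pi.single i (1:ℝ))

/-- The fermionic partial derivative ∂_{x`_i}, the odd derivation with
∂_{x`_i}(x`_j) = δ_{ij}: contraction with the i-th dual basis vector. -/
def fpderiv (n : ℕ) (i : Fin (2*n)) : Grass n →ₗ[ℝ] Grass n :=
  CliffordAlgebra.contractLeft (LinearMap.proj i)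

/-- The fermionic Laplace operator Δ_f = 4∑_j ∂_{x`_{2j−1}}∂_{x`_{2j}}. -/
def lapF (n : ℕ) : Grass n →ₗ[ℝ] Grass n :=
  (4:ℝ) • ∑ j : Fin n,
    (fpderiv n ⟨2*j.1, by omega⟩) ∘ₗ (fpderiv n ⟨2*j.1+1, by omega⟩)

/-- x`² = ∑_{j=1}^n x`_{2j−1} x`_{2j}. -/
def rf2 (n : ℕ) : Grass n := ∑ j : Fin n, fgen n ⟨2*j.1, by omega⟩ * fgen n ⟨2*j.1+1, by omega⟩

/-- The degree-`k` homogeneous part 𝒫^f_k of the Grassmann algebra. -/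
def Pf (n : ℕ) (k : ℕ) : Submodule ℝ (Grass n) :=
  (LinearMap.range (ExteriorAlgebra.ι ℝ (M := Fin (2*n) → ℝ)))^k

/-- The space ℋ^f_k of fermionic (symplectic) harmonics of degree k. -/
def Hf (n : ℕ) (k : ℕ) : Submodule ℝ (Grass n) :=
  Pf n k ⊓ LinearMap.ker (lapF n)

/-- x`^{2i} ℋ^f_{k−2i} as a subspace of Λ_{2n}. -/
def fFischerPiece (n k i : ℕ) : Submodule ℝ (Grass n) :=
  Submodule.map (LinearMap.mulLeft ℝ ((rf2 n)^i)) (Hf n (k - 2*i))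

/-- x`^{2(n−k+i)} ℋ^f_{k−2i} as a subspace of Λ_{2n}. -/
def fFischerPiece' (n k i : ℕ) : Submodule ℝ (Grass n) :=
  Submodule.map (LinearMap.mulLeft ℝ ((rf2 n)^(n - k + i))) (Hf n (k - 2*i))

section

variable {n : ℕ}

lemma fpderiv_ι_mul (i : Fin (2*n)) (m : Fin (2*n) → ℝ) (v : Grass n) :
    fpderiv n i (ExteriorAlgebra.ι ℝ m * v) =
      m i • v - ExteriorAlgebra.ι ℝ m * fpderiv n i v :=
  CliffordAlgebra.contractLeft_ι_mul _ _ _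

lemma fpderiv_fgen_mul (i j : Fin (2*n)) (v : Grass n) :
    fpderiv n i (fgen n j * v) =
      (if i = j then v else 0) - fgen n j * fpderiv n i v := by
  rw [fgen, fpderiv_ι_mul, Pi.single_apply, ite_smul, one_smul, zero_smul]

lemma fpderiv_algebraMap (i : Fin (2*n)) (r : ℝ) :
    fpderiv n i (algebraMap ℝ (Grass n) r) = 0 :=
  CliffordAlgebra.contractLeft_algebraMap _ _ r

lemma ι_mem_Pf_one (m : Fin (2*n) → ℝ) : ExteriorAlgebra.ι ℝ m ∈ Pf n 1 := by
  rw [Pf, pow_one]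
  exact LinearMap.mem_range_self _ m

lemma mul_mem_Pf {k l : ℕ} {u v : Grass n} (hu : u ∈ Pf n k) (hv : v ∈ Pf n l) :
    u * v ∈ Pf n (k + l) := by
  rw [Pf, pow_add]
  exact Submodule.mul_mem_mul hu hv

lemma rf2_mem_Pf_two : rf2 n ∈ Pf n 2 :=
  Submodule.sum_mem _ fun _ _ => mul_mem_Pf (ι_mem_Pf_one _) (ι_mem_Pf_one _)

lemma rf2_pow_mem_Pf (i : ℕ) : rf2 n ^ i ∈ Pf n (2*i) := by
  rw [Pf, pow_mul]
  exact Submodule.pow_mem_pow _ rf2_mem_Pf_two i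

/-- A property of homogeneous elements that holds for scalars and is stable under addition and
left multiplication by degree-one elements holds for all homogeneous elements. -/
lemma Pf_induction {C : ℕ → Grass n → Prop}
    (scalar : ∀ r : ℝ, C 0 (algebraMap ℝ (Grass n) r))
    (add : ∀ k, ∀ u ∈ Pf n k, ∀ v ∈ Pf n k, C k u → C k v → C k (u + v))
    (ι_mul : ∀ k m, ∀ v ∈ Pf n k, C k v → C (k + 1) (ExteriorAlgebra.ι ℝ m * v))
    {k : ℕ} {v : Grass n} (hv : v ∈ Pf n k) : C k v := by
  refine Submodule.pow_induction_on_left' (C := fun k v _ => C k v) _ scalar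
    (fun x y i hx hy => add i x hx y hy) ?_ hv
  rintro _ ⟨m, rfl⟩ i x hx
  exact ι_mul i m x hx

lemma fpderiv_mem_Pf_pred (i : Fin (2*n)) {k : ℕ} {v : Grass n} (hv : v ∈ Pf n k) :
    fpderiv n i v ∈ Pf n (k - 1) ∧ (k = 0 → fpderiv n i v = 0) := by
  refine Pf_induction (C := fun k v => fpderiv n i v ∈ Pf n (k - 1) ∧
    (k = 0 → fpderiv n i v = 0)) ?_ ?_ ?_ hv
  · intro r
    simp [fpderiv_algebraMap]
  · rintro k u - v - ⟨hu, hu0⟩ ⟨hv, hv0⟩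
    rw [map_add]
    exact ⟨add_mem hu hv, fun h => by rw [hu0 h, hv0 h, add_zero]⟩
  · rintro k m v hv ⟨h, h0⟩
    refine ⟨?_, fun h => absurd h (Nat.succ_ne_zero k)⟩
    rw [fpderiv_ι_mul]
    refine sub_mem (Submodule.smul_mem _ _ hv) ?_
    rcases Nat.eq_zero_or_pos k with rfl | hk
    · rw [h0 rfl, mul_zero]
      exact zero_mem _
    · have := mul_mem_Pf (ι_mem_Pf_one m) h
      rwa [show 1 + (k - 1) = k + 1 - 1 by omega] at this

lemma lapF_mem_Pf {k : ℕ} {v : Grass n} (hv : v ∈ Pf n (k + 2)) : lapF n v ∈ Pf n k := by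
  rw [lapF, LinearMap.smul_apply, LinearMap.sum_apply]
  exact Submodule.smul_mem _ _ <| Submodule.sum_mem _ fun j _ =>
    (fpderiv_mem_Pf_pred _ (fpderiv_mem_Pf_pred _ hv).1).1

lemma lapF_eq_zero {k : ℕ} (hk : k < 2) {v : Grass n} (hv : v ∈ Pf n k) : lapF n v = 0 := by
  rw [lapF, LinearMap.smul_apply, LinearMap.sum_apply]
  refine smul_eq_zero_of_right _ (Finset.sum_eq_zero fun j _ => ?_)
  exact (fpderiv_mem_Pf_pred _ (fpderiv_mem_Pf_pred _ hv).1).2 (by omega)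

lemma sum_fin_two_mul {M : Type*} [AddCommMonoid M] (n : ℕ) (f : Fin (2*n) → M) :
    ∑ i, f i = ∑ j : Fin n, (f ⟨2*j.1, by omega⟩ + f ⟨2*j.1+1, by omega⟩) := by
  induction n with
  | zero => rfl
  | succ n ih =>
    rw [Fin.sum_univ_castSucc (n := n), ← add_assoc]
    refine (Fin.sum_univ_castSucc (n := 2*n+1) f).trans ?_
    rw [Fin.sum_univ_castSucc]
    congr 2
    exact ih fun i => f ⟨i.1, by omega⟩

lemma ι_eq_sum (m : Fin (2*n) → ℝ) :
    ExteriorAlgebra.ι ℝ m = ∑ i, m i • fgen n i := by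
  simp only [fgen, ← map_smul, ← map_sum]
  congr 1
  exact pi_eq_sum_univ' m

/-- The Euler operator acts on `Pf n k` as multiplication by `k`. -/
lemma sum_fgen_mul_fpderiv {k : ℕ} {v : Grass n} (hv : v ∈ Pf n k) :
    ∑ i, fgen n i * fpderiv n i v = (k : ℝ) • v := by
  refine Pf_induction (C := fun k v => ∑ i, fgen n i * fpderiv n i v = (k : ℝ) • v) ?_ ?_ ?_ hv
  · intro r
    simp [fpderiv_algebraMap]
  · intro k u _ v _ hu hv
    simp only [map_add, mul_add, Finset.sum_add_distrib, hu, hv, smul_add]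
  · intro k m v _ hv
    have key (i : Fin (2*n)) : fgen n i * fpderiv n i (ExteriorAlgebra.ι ℝ m * v) =
        (m i • fgen n i) * v + ExteriorAlgebra.ι ℝ m * (fgen n i * fpderiv n i v) := by
      have anti : fgen n i * ExteriorAlgebra.ι ℝ m = -(ExteriorAlgebra.ι ℝ m * fgen n i) :=
        eq_neg_of_add_eq_zero_left (ExteriorAlgebra.ι_add_mul_swap _ _)
      rw [fpderiv_ι_mul, mul_sub, ← mul_assoc, anti, neg_mul, sub_neg_eq_add, mul_assoc,
        mul_smul_comm, smul_mul_assoc]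
    simp only [key, Finset.sum_add_distrib, ← Finset.sum_mul, ← Finset.mul_sum, ← ι_eq_sum, hv]
    push_cast
    rw [mul_smul_comm, add_smul, one_smul, add_comm]

/-- The commutation relation between the Laplace operator and multiplication by `rf2 n`. -/
lemma lapF_rf2_mul {k : ℕ} {v : Grass n} (hv : v ∈ Pf n k) :
    lapF n (rf2 n * v) = rf2 n * lapF n v + (4 * ((k : ℝ) - n)) • v := by
  have key (i j : Fin n) :
      fpderiv n ⟨2*j.1, by omega⟩ (fpderiv n ⟨2*j.1+1, by omega⟩
        (fgen n ⟨2*i.1, by omega⟩ * fgen n ⟨2*i.1+1, by omega⟩ * v)) =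
      fgen n ⟨2*i.1, by omega⟩ * fgen n ⟨2*i.1+1, by omega⟩ *
        fpderiv n ⟨2*j.1, by omega⟩ (fpderiv n ⟨2*j.1+1, by omega⟩ v) +
      if i = j then
        fgen n ⟨2*j.1, by omega⟩ * fpderiv n ⟨2*j.1, by omega⟩ v +
        fgen n ⟨2*j.1+1, by omega⟩ * fpderiv n ⟨2*j.1+1, by omega⟩ v - v
      else 0 := by
    have h₁ : 2*j.1+1 ≠ 2*i.1 := by omega
    have h₂ : 2*j.1 ≠ 2*i.1+1 := by omega
    rw [mul_assoc, fpderiv_fgen_mul, fpderiv_fgen_mul]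
    by_cases hij : i = j
    · subst hij
      simp only [Fin.mk.injEq, h₁, h₂, if_true, if_false, zero_sub, mul_sub, map_neg, map_sub,
        fpderiv_fgen_mul, mul_assoc, mul_neg]
      abel
    · have hij' : j.1 ≠ i.1 := fun h => hij (Fin.ext h.symm)
      simp only [Fin.mk.injEq, h₁, h₂, hij, hij', if_false, zero_sub, map_neg,
        fpderiv_fgen_mul, mul_assoc, mul_neg, add_left_inj, mul_eq_mul_left_iff,
        OfNat.ofNat_ne_zero, or_false]
      abel
  have euler := sum_fgen_mul_fpderiv hv
  rw [sum_fin_two_mul] at euler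
  simp only [lapF, rf2, LinearMap.smul_apply, LinearMap.sum_apply, LinearMap.comp_apply,
    Finset.sum_mul, map_sum, key, Finset.sum_add_distrib, ← Finset.smul_sum, ← Finset.mul_sum,
    Finset.sum_ite_eq, Finset.mem_univ, if_true, Finset.sum_sub_distrib]
  rw [← Finset.sum_add_distrib, euler, Finset.sum_const, Finset.card_univ, Fintype.card_fin,
    ← Nat.cast_smul_eq_nsmul ℝ n, ← sub_smul, smul_add, mul_smul]
  simp only [mul_smul_comm, ← Finset.smul_sum]

lemma rf2_pow_mul_mem_Pf {p i k : ℕ} (hk : p + 2*i = k) {v : Grass n} (hv : v ∈ Pf n p) :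
    rf2 n ^ i * v ∈ Pf n k := by
  rw [← hk, add_comm]
  exact mul_mem_Pf (rf2_pow_mem_Pf i) hv

lemma lapF_rf2_pow_succ_mul {p : ℕ} {h : Grass n} (hh : h ∈ Hf n p) (i : ℕ) :
    lapF n (rf2 n ^ (i + 1) * h) =
      (4 * (i + 1) * ((p : ℝ) - n + i)) • (rf2 n ^ i * h) := by
  induction i with
  | zero =>
    rw [zero_add, pow_one, lapF_rf2_mul hh.1, LinearMap.mem_ker.mp hh.2]
    simp
  | succ i ih =>
    rw [pow_succ', mul_assoc, lapF_rf2_mul (rf2_pow_mul_mem_Pf rfl hh.1), ih, mul_smul_comm,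
      ← mul_assoc, ← pow_succ', ← add_smul]
    congr 1
    push_cast
    ring

lemma eq_zero_of_rf2_pow_mul_eq_zero {p : ℕ} {h : Grass n} (hh : h ∈ Hf n p) {i : ℕ}
    (hi : i + p ≤ n) (h0 : rf2 n ^ i * h = 0) : h = 0 := by
  induction i with
  | zero => simpa using h0
  | succ i ih =>
    refine ih (by omega) ?_
    have := lapF_rf2_pow_succ_mul hh i
    rw [h0, map_zero, eq_comm, smul_eq_zero] at this
    refine this.resolve_left (mul_ne_zero (by positivity) (ne_of_lt ?_))
    have : (i : ℝ) + 1 + p ≤ n := by exact_mod_cast hi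
    linarith

/-- The subspaces `rf2 n ^ (a + i) * Hf n (k - 2*i)` are independent, since they lie in different
eigenspaces of the composition of the Laplace operator with multiplication by `rf2 n`. -/
lemma iSupIndep_map_rf2_pow_Hf {k : ℕ} (hk : k ≤ n) (a : ℕ) :
    iSupIndep fun i : Fin (k/2 + 1) =>
      (Hf n (k - 2*i.1)).map (LinearMap.mulLeft ℝ (rf2 n ^ (a + i.1))) := by
  let μ (i : Fin (k/2 + 1)) : ℝ := 4 * (a + i.1) * ((k : ℝ) - n + a - 1 - i.1)
  have hμ : Function.Injective μ := by
    intro i j hij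
    by_contra hne
    have h₁ : ((i.1 : ℝ) - j.1) * (k - n - 1 - i.1 - j.1) = 0 := by
      simp only [μ] at hij
      linear_combination hij / 4
    have hk' : (k : ℝ) ≤ n := by exact_mod_cast hk
    have hi : (0 : ℝ) ≤ i.1 := Nat.cast_nonneg _
    have hj : (0 : ℝ) ≤ j.1 := Nat.cast_nonneg _
    rcases mul_eq_zero.mp h₁ with h | h
    · exact hne (Fin.ext (by exact_mod_cast sub_eq_zero.mp h))
    · linarith
  refine ((Module.End.eigenspaces_iSupIndep
    (LinearMap.mulLeft ℝ (rf2 n) ∘ₗ lapF n)).comp hμ).mono ?_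
  rintro i _ ⟨h, hh, rfl⟩
  refine Module.End.mem_eigenspace_iff.mpr ?_
  have hki : ((k - 2*i.1 : ℕ) : ℝ) = k - 2*i.1 := by
    rw [Nat.cast_sub (by omega)]
    push_cast
    rfl
  simp only [LinearMap.comp_apply, LinearMap.mulLeft_apply, μ]
  rcases hm : a + i.1 with _ | m
  · rw [pow_zero, one_mul, LinearMap.mem_ker.mp hh.2, mul_zero, ← Nat.cast_add, hm]
    simp
  · rw [lapF_rf2_pow_succ_mul hh, mul_smul_comm, ← mul_assoc, ← pow_succ', hki]
    have : (a : ℝ) + i.1 = m + 1 := by exact_mod_cast hm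
    congr 1
    rw [this, show (m : ℝ) = a + i.1 - 1 by linarith]
    ring

lemma fFischerPiece_le_Pf {k i : ℕ} (hi : i ≤ k/2) : fFischerPiece n k i ≤ Pf n k := by
  rintro _ ⟨h, hh, rfl⟩
  exact rf2_pow_mul_mem_Pf (by omega) hh.1

lemma Pf_eq_iSup_fFischerPiece {k : ℕ} (hk : k ≤ n) :
    Pf n k = ⨆ i : Fin (k/2 + 1), fFischerPiece n k i.1 := by
  refine le_antisymm ?_ (iSup_le fun i => fFischerPiece_le_Pf (Nat.le_of_lt_succ i.2))
  have harm {k : ℕ} : Hf n k ≤ ⨆ i : Fin (k/2 + 1), fFischerPiece n k i.1 := by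
    refine le_trans ?_ (le_iSup _ ⟨0, by omega⟩)
    intro h hh
    exact ⟨h, hh, by simp⟩
  induction k using Nat.strong_induction_on with
  | _ k ih =>
    intro v hv
    rcases Nat.lt_or_ge k 2 with hk2 | hk2
    · exact harm ⟨hv, LinearMap.mem_ker.mpr (lapF_eq_zero hk2 hv)⟩
    obtain ⟨k, rfl⟩ := Nat.exists_eq_add_of_le' hk2
    have ihk := ih k (by omega) (by omega)
    have surj : Pf n k ≤ (Pf n k).map (lapF n ∘ₗ LinearMap.mulLeft ℝ (rf2 n)) := by
      refine ihk.trans (iSup_le ?_)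
      rintro i _ ⟨h, hh, rfl⟩
      have hc : (4 * (i.1 + 1) * (((k - 2*i.1 : ℕ) : ℝ) - n + i.1)) ≠ 0 := by
        refine mul_ne_zero (by positivity) (ne_of_lt ?_)
        have : ((k - 2*i.1 : ℕ) : ℝ) + i.1 < n := by
          exact_mod_cast (by omega : k - 2*i.1 + i.1 < n)
        linarith
      refine ⟨_, Submodule.smul_mem _ (4 * (i.1 + 1) * (((k - 2*i.1 : ℕ) : ℝ) - n + i.1))⁻¹
        (rf2_pow_mul_mem_Pf (i := i.1) (by omega) hh.1), ?_⟩
      rw [map_smul, LinearMap.comp_apply, LinearMap.mulLeft_apply, ← mul_assoc, ← pow_succ',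
        lapF_rf2_pow_succ_mul hh, inv_smul_smul₀ hc]
      rfl
    obtain ⟨u, hu, huv⟩ := surj (lapF_mem_Pf hv)
    have hru : rf2 n * u ∈ Pf n (k + 2) := by
      simpa using rf2_pow_mul_mem_Pf (i := 1) rfl hu
    rw [← sub_add_cancel v (rf2 n * u)]
    refine add_mem (harm ⟨sub_mem hv hru, ?_⟩) ?_
    · rw [SetLike.mem_coe, LinearMap.mem_ker, map_sub, ← huv]
      exact sub_self _
    · have : (⨆ i : Fin (k/2 + 1), fFischerPiece n k i.1).map (LinearMap.mulLeft ℝ (rf2 n)) ≤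
          ⨆ i : Fin ((k + 2)/2 + 1), fFischerPiece n (k + 2) i.1 := by
        rw [Submodule.map_iSup]
        refine iSup_le fun i => le_trans ?_ (le_iSup _ ⟨i.1 + 1, by omega⟩)
        rintro _ ⟨_, ⟨h, hh, rfl⟩, rfl⟩
        refine ⟨h, ?_, ?_⟩
        · rwa [show k + 2 - 2*(i.1 + 1) = k - 2*i.1 by omega]
        · simp only [LinearMap.mulLeft_apply, pow_succ', mul_assoc]
      exact this (Submodule.mem_map_of_mem (ihk hu))

lemma eq_zero_of_mem_Pf_of_rf2_pow_mul_eq_zero {k : ℕ} (hk : k ≤ n) {v : Grass n}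
    (hv : v ∈ Pf n k) (h0 : rf2 n ^ (n - k) * v = 0) : v = 0 := by
  rw [Pf_eq_iSup_fFischerPiece hk, Submodule.mem_iSup_iff_exists_finsupp] at hv
  obtain ⟨f, hf, rfl⟩ := hv
  choose h hh hhf using hf
  simp only [LinearMap.mulLeft_apply] at hhf
  refine Finset.sum_eq_zero fun i hi => ?_
  rw [Finsupp.sum, Finset.mul_sum] at h0
  have := (iSupIndep_iff_finsetSum_eq_zero_imp_eq_zero _).mp
    (iSupIndep_map_rf2_pow_Hf hk (n - k)) f.support (fun i => rf2 n ^ (n - k) * f i)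
    (fun i _ => ⟨h i, hh i, by rw [LinearMap.mulLeft_apply, ← hhf, ← mul_assoc, pow_add]⟩)
    h0 i hi
  rw [← hhf, ← mul_assoc, ← pow_add] at this
  rw [← hhf, eq_zero_of_rf2_pow_mul_eq_zero (hh i) (by omega) this, mul_zero]

lemma finrank_Pf (n k : ℕ) : Module.finrank ℝ (Pf n k) = (2*n).choose k := by
  refine (exteriorPower.finrank_eq ℝ k).trans ?_
  rw [Module.finrank_fin_fun]

lemma map_rf2_pow_Pf {k : ℕ} (hk : k ≤ n) :
    (Pf n k).map (LinearMap.mulLeft ℝ (rf2 n ^ (n - k))) = Pf n (2*n - k) := by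
  have : FiniteDimensional ℝ (Pf n (2*n - k)) :=
    inferInstanceAs (Module.Finite ℝ (⋀[ℝ]^(2*n - k) (Fin (2*n) → ℝ)))
  refine Submodule.eq_of_le_of_finrank_eq ?_ ?_
  · rintro _ ⟨v, hv, rfl⟩
    exact rf2_pow_mul_mem_Pf (by omega) hv
  · let g := (LinearMap.mulLeft ℝ (rf2 n ^ (n - k))).domRestrict (Pf n k)
    have hg : Function.Injective g := by
      refine (injective_iff_map_eq_zero g).mpr fun v hv => ?_
      exact Subtype.ext (eq_zero_of_mem_Pf_of_rf2_pow_mul_eq_zero hk v.2 hv)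
    rw [← LinearMap.range_domRestrict, LinearMap.finrank_range_of_inj hg, finrank_Pf, finrank_Pf,
      Nat.choose_symm (by omega)]

end

/-- fermionic Fischer decomposition: for 0 ≤ k ≤ n,
(i) 𝒫^f_k = ⊕_{i=0}^{⌊k/2⌋} x`^{2i} ℋ^f_{k−2i} (internal direct sum);
(ii) multiplication by x`^{2(n−k)} is a linear isomorphism of 𝒫^f_k onto 𝒫^f_{2n−k};
(iii) 𝒫^f_{2n−k} = ⊕_{i=0}^{⌊k/2⌋} x`^{2(n−k+i)} ℋ^f_{k−2i} (internal direct sum). -/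
theorem fermionic_fischer (n : ℕ) (hn : 1 ≤ n) (k : ℕ) (hk : k ≤ n) :
    -- (i)
    (Pf n k = (⨆ i : Fin (k/2 + 1), fFischerPiece n k i.1) ∧
      iSupIndep (fun i : Fin (k/2 + 1) => fFischerPiece n k i.1)) ∧
    -- (ii)
    (Submodule.map (LinearMap.mulLeft ℝ ((rf2 n)^(n - k))) (Pf n k) = Pf n (2*n - k) ∧
      ∀ v ∈ Pf n k, (rf2 n)^(n - k) * v = 0 → v = 0) ∧
    -- (iii)
    (Pf n (2*n - k) = (⨆ i : Fin (k/2 + 1), fFischerPiece' n k i.1) ∧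
      iSupIndep (fun i : Fin (k/2 + 1) => fFischerPiece' n k i.1)) := by
  refine ⟨⟨Pf_eq_iSup_fFischerPiece hk, ?_⟩, ⟨map_rf2_pow_Pf hk, fun v hv h0 =>
    eq_zero_of_mem_Pf_of_rf2_pow_mul_eq_zero hk hv h0⟩, ?_, iSupIndep_map_rf2_pow_Hf hk (n - k)⟩
  · simpa only [zero_add, fFischerPiece] using iSupIndep_map_rf2_pow_Hf hk 0
  · rw [← map_rf2_pow_Pf hk, Pf_eq_iSup_fFischerPiece hk, Submodule.map_iSup]
    refine iSup_congr fun i => ?_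
    rw [fFischerPiece, fFischerPiece', ← Submodule.map_comp, pow_add, LinearMap.mulLeft_mul]


end
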